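/- Let φ : ℝ² → ℝ be smooth, let λ ≠ 0 be real, and let U : ℝ² → M₂(ℂ) be a smooth map satisfying the Lax system ∂ₓU = U·A_φ(·,·,λ), ∂_yU = U·B_φ(·,·,λ) with U(x,y) invertible for all (x,y). Define N(x,y) := U(x,y)·σ₃·U(x,y)⁻¹. Then ∂_y∂ₓN(x,y) = cos(φ(x,y))·N(x,y) for all (x,y) ∈ ℝ². In particular the Gauss map N is Lorentz-harmonic: N_{xy} = ρ·N with the real-valued function ρ = cos φ. -/

import Mathlib

open Matrix Complex

attribute [local instance] Matrix.normedAddCommGroup Matrix.normedSpace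

noncomputable section

/-- The Pauli matrix σ₃. -/
def sigma3 : Matrix (Fin 2) (Fin 2) ℂ := !![1, 0; 0, -1]

/-- The matrix `A_φ(x,y,λ) = (i/2)·[[∂ₓφ, −λ], [−λ, −∂ₓφ]]` of the Lax system. -/
def Aphi (φ : ℝ → ℝ → ℝ) (lam : ℂ) (x y : ℝ) : Matrix (Fin 2) (Fin 2) ℂ :=
  (Complex.I / 2) •
    !![((deriv (fun x' => φ x' y) x : ℝ) : ℂ), -lam;
       -lam, -((deriv (fun x' => φ x' y) x : ℝ) : ℂ)]

/-- The matrix `B_φ(x,y,λ) = (i/2)·λ⁻¹·[[0, e^{−iφ}], [e^{iφ}, 0]]` of the Lax system. -/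
def Bphi (φ : ℝ → ℝ → ℝ) (lam : ℂ) (x y : ℝ) : Matrix (Fin 2) (Fin 2) ℂ :=
  (Complex.I / 2) • lam⁻¹ •
    !![0, Complex.exp (-Complex.I * ((φ x y : ℝ) : ℂ));
       Complex.exp (Complex.I * ((φ x y : ℝ) : ℂ)), 0]

/-- Membership in SU(2): unitary with determinant one. -/
def IsSU2 (g : Matrix (Fin 2) (Fin 2) ℂ) : Prop := g * gᴴ = 1 ∧ g.det = 1

/-- The bilinear pairing `⟨X,Y⟩ = −2·tr(X·Y)` on 2×2 complex matrices. -/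
def pairing (X Y : Matrix (Fin 2) (Fin 2) ℂ) : ℂ := -2 * (X * Y).trace

section Conjugation

attribute [local instance] Matrix.linftyOpNormedAddCommGroup Matrix.linftyOpNormedRing
  Matrix.linftyOpNormedSpace Matrix.linftyOpNormedAlgebra

theorem hasDerivAt_conj_of_linftyOp {V : ℝ → Matrix (Fin 2) (Fin 2) ℂ}
    {A : Matrix (Fin 2) (Fin 2) ℂ} {t : ℝ} (M : Matrix (Fin 2) (Fin 2) ℂ)
    (hV : HasDerivAt V (V t * A) t) (hu : IsUnit (V t)) :
    HasDerivAt (fun s => V s * M * (V s)⁻¹) (V t * (A * M - M * A) * (V t)⁻¹) t := by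
  obtain ⟨u, hu⟩ := hu
  have hinv : HasDerivAt (fun s => (V s)⁻¹) (-(A * (V t)⁻¹)) t := by
    have hf := hasFDerivAt_ringInverse (𝕜 := ℝ) u
    rw [hu] at hf
    have hval : (↑u⁻¹ : Matrix (Fin 2) (Fin 2) ℂ) = (V t)⁻¹ := by
      rw [← hu, Matrix.coe_units_inv]
    have hcancel : (V t)⁻¹ * V t = 1 := by rw [← hval, ← hu, Units.inv_mul]
    have h := (hf.comp_hasDerivAt t hV).congr_deriv (g' := -(A * (V t)⁻¹)) (by
      simp [← mul_assoc, hcancel, hval])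
    simp only [Function.comp_def, ← Matrix.nonsing_inv_eq_ringInverse] at h
    exact h
  refine ((hV.mul_const M).mul hinv).congr_deriv ?_
  simp only [mul_sub, sub_mul, mul_neg, ← sub_eq_add_neg, mul_assoc]

end Conjugation

/-- If `V' = V * A` then `(V * M * V⁻¹)' = V * [A, M] * V⁻¹`. -/
theorem hasDerivAt_conj {V : ℝ → Matrix (Fin 2) (Fin 2) ℂ}
    {A : Matrix (Fin 2) (Fin 2) ℂ} {t : ℝ} (M : Matrix (Fin 2) (Fin 2) ℂ)
    (hV : HasDerivAt V (V t * A) t) (hu : IsUnit (V t)) :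
    HasDerivAt (fun s => V s * M * (V s)⁻¹) (V t * (A * M - M * A) * (V t)⁻¹) t :=
  hasDerivAt_conj_of_linftyOp M hV hu

theorem Aphi_commutator_sigma3 (φ : ℝ → ℝ → ℝ) (lam : ℂ) (x y : ℝ) :
    Aphi φ lam x y * sigma3 - sigma3 * Aphi φ lam x y
      = !![0, Complex.I * lam; -Complex.I * lam, 0] := by
  ext i j
  fin_cases i <;> fin_cases j <;> simp [Aphi, sigma3] <;> ring

theorem Bphi_commutator (φ : ℝ → ℝ → ℝ) {lam : ℂ} (hlam : lam ≠ 0) (x y : ℝ) :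
    Bphi φ lam x y * !![0, Complex.I * lam; -Complex.I * lam, 0]
        - !![0, Complex.I * lam; -Complex.I * lam, 0] * Bphi φ lam x y
      = ((Real.cos (φ x y) : ℝ) : ℂ) • sigma3 := by
  ext i j
  fin_cases i <;> fin_cases j <;>
    simp [Bphi, sigma3, Complex.cos, mul_comm Complex.I] <;> field_simp <;> simp

/-- The Gauss map `N = U·σ₃·U⁻¹` built from a solution `U` of the Lax system of `φ` is
Lorentz-harmonic: `∂_y∂ₓN = cos(φ)·N`, i.e. `N_{xy} = ρ·N` with `ρ = cos φ`. -/
theorem gauss_map_lorentz_harmonic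
    (φ : ℝ → ℝ → ℝ) (hφ : ContDiff ℝ (⊤ : ℕ∞) (fun p : ℝ × ℝ => φ p.1 p.2))
    (lam : ℝ) (hlam : lam ≠ 0)
    (U : ℝ → ℝ → Matrix (Fin 2) (Fin 2) ℂ)
    (hUsm : ContDiff ℝ (⊤ : ℕ∞) (fun p : ℝ × ℝ => U p.1 p.2))
    (hLax : ∀ x y : ℝ,
      HasDerivAt (fun x' => U x' y) (U x y * Aphi φ (lam : ℂ) x y) x ∧
      HasDerivAt (fun y' => U x y') (U x y * Bphi φ (lam : ℂ) x y) y)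
    (hUinv : ∀ x y : ℝ, IsUnit (U x y)) :
    ∀ x y : ℝ,
      deriv (fun y' => deriv (fun x' => U x' y' * sigma3 * (U x' y')⁻¹) x) y
        = ((Real.cos (φ x y) : ℝ) : ℂ) • (U x y * sigma3 * (U x y)⁻¹) := by
  intro x y
  have hx : (fun y' => deriv (fun x' => U x' y' * sigma3 * (U x' y')⁻¹) x)
      = fun y' => U x y' * !![0, Complex.I * lam; -Complex.I * lam, 0] * (U x y')⁻¹ := by
    funext y'
    refine (hasDerivAt_conj (V := fun x' => U x' y') sigma3 (hLax x y').1 (hUinv x y')).deriv.trans ?_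
    rw [Aphi_commutator_sigma3]
  rw [hx]
  refine (hasDerivAt_conj (V := fun y' => U x y') _ (hLax x y).2 (hUinv x y)).deriv.trans ?_
  rw [Bphi_commutator φ (by exact_mod_cast hlam), Matrix.mul_smul, Matrix.smul_mul]

end
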